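/- Let k be an algebraically closed field of characteristic 0, and let f, g ∈ k(x,y)* with divisors D = div(f), E = div(g) on ℙ². Assume: (i) for every height-one prime p of k[x,y], the tame symbols ∂_p{f,g} and ∂_p{x,y} agree up to multiplication by an element of k*; (ii) l_h is a component of D and l_v is a component of E; (iii) D and E have no common irreducible components except possibly l_∞; (iv) |D⁺| ∩ |D⁻| ∩ |E⁺| ∩ |E⁻| = ∅. Then every irreducible component C of D or of E with C ≠ l_h and C ≠ l_v does not pass through the point 0 = [0:0:1]. -/

import Mathlib

open scoped TensorProduct

/-- Pre-K₂: the tensor square (over ℤ) of the unit group `F*`, written additively. -/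
abbrev K2Pre (F : Type) [Field F] : Type :=
  (Additive Fˣ) ⊗[ℤ] (Additive Fˣ)

/-- The subgroup of Steinberg relations, generated by the elements `f ⊗ (1 - f)`
for `f ∈ F*`, `f ≠ 1`. -/
noncomputable def steinberg (F : Type) [Field F] : Submodule ℤ (K2Pre F) :=
  Submodule.span ℤ {t | ∃ (f : Fˣ) (h : (1 : F) - (f : F) ≠ 0),
    t = Additive.ofMul f ⊗ₜ[ℤ] Additive.ofMul (Units.mk0 ((1 : F) - (f : F)) h)}

/-- The second Milnor K-group `K₂ᴹ(F)`. -/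
noncomputable abbrev MilnorK2 (F : Type) [Field F] : Type :=
  K2Pre F ⧸ steinberg F

/-- The symbol `{f, g} ∈ K₂ᴹ(F)`. -/
noncomputable def MilnorK2.symbol {F : Type} [Field F] (f g : Fˣ) : MilnorK2 F :=
  Submodule.Quotient.mk (Additive.ofMul f ⊗ₜ[ℤ] Additive.ofMul g)

/-- The subgroup of `K₂ᴹ(F)` generated by the symbols `{f, c}` with `f ∈ F*`, `c ∈ k*`. -/
noncomputable def constSymbols (k F : Type) [Field k] [Field F] [Algebra k F] :
    AddSubgroup (MilnorK2 F) :=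
  AddSubgroup.closure {ξ | ∃ (f : Fˣ) (c : kˣ),
    ξ = MilnorK2.symbol f (Units.map (algebraMap k F).toMonoidHom c)}

/-- `K₂(F)/Const`. -/
noncomputable abbrev K2ModConst (k F : Type) [Field k] [Field F] [Algebra k F] : Type :=
  MilnorK2 F ⧸ constSymbols k F

/-- The class of the symbol `{f, g}` in `K₂(F)/Const`, as a total function on `F`
(junk value `0` if `f` or `g` vanishes). -/
noncomputable def K2ModConst.symb (k : Type) {F : Type} [Field k] [Field F] [Algebra k F]
    (f g : F) : K2ModConst k F :=
  letI := Classical.propDecidable (f ≠ 0 ∧ g ≠ 0)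
  if h : f ≠ 0 ∧ g ≠ 0 then
    QuotientAddGroup.mk (MilnorK2.symbol (Units.mk0 f h.1) (Units.mk0 g h.2))
  else 0

/-- The height-one points of `Spec R` (i.e. height-one primes of `R`). -/
def H1 (R : Type) [CommRing R] : Type := {p : PrimeSpectrum R // Order.height p = 1}

/-- The height-two points of `Spec R` (i.e. height-two primes of `R`). -/
def H2 (R : Type) [CommRing R] : Type := {q : PrimeSpectrum R // Order.height q = 2}

/-- The residue field `κ(p) = Frac(R/p)` of a prime `p`. -/
noncomputable abbrev kappa {R : Type} [CommRing R] (p : PrimeSpectrum R) : Type :=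
  FractionRing (R ⧸ p.asIdeal)

/-- The residue class in `κ(p)` of an element of `R`. -/
noncomputable def resid {R : Type} [CommRing R] (p : PrimeSpectrum R) (r : R) : kappa p :=
  algebraMap (R ⧸ p.asIdeal) (kappa p) (Ideal.Quotient.mk p.asIdeal r)

/-- The `n`-th symbolic power of a prime `p`: the contraction of `(p R_p)^n` from the
localization of `R` at `p`.  For `f` in `R`, the valuation `ν_p(f) ≥ n` iff
`f ∈ symbPow p n`; this is used below to pin down the discrete valuation `ν_p`. -/
noncomputable def symbPow {R : Type} [CommRing R] (p : PrimeSpectrum R) (n : ℕ) : Ideal R :=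
  Ideal.comap (algebraMap R (Localization.AtPrime p.asIdeal))
    (Ideal.map (algebraMap R (Localization.AtPrime p.asIdeal)) p.asIdeal ^ n)

/-- `lengthQuot Q hQ c` is the length of the module `A_Q/(c)` over the local ring `A_Q`
(the localization of `A` at the prime `Q`), expressed as the Krull dimension (= supremum of
lengths of strictly increasing chains) of its lattice of submodules, which for any module
equals its Jordan–Hölder length.  This is the order function `ord_Q(c)` of the local ring
`A_Q`. -/
noncomputable def lengthQuot {A : Type} [CommRing A] (Q : Ideal A) (hQ : Q.IsPrime) (c : A) :
    WithBot ℕ∞ :=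
  haveI := hQ
  Order.krullDim (Submodule (Localization.AtPrime Q)
    (Localization.AtPrime Q ⧸ Ideal.span {algebraMap A (Localization.AtPrime Q) c}))

open MvPolynomial
open scoped LinearAlgebra.Projectivization

/-- The points of the projective plane `ℙ²_k`. -/
abbrev P2 (k : Type) [Field k] : Type := Projectivization k (Fin 3 → k)

/-- Homogenization: the image in `k[X,Y,Z]` of a polynomial `a ∈ k[x,y]`, obtained by
multiplying each monomial `x^i y^j` by `X^i Y^j Z^(d - i - j)` where `d = deg a`. -/
noncomputable def homog {k : Type} [Field k] (a : MvPolynomial (Fin 2) k) :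
    MvPolynomial (Fin 3) k :=
  ∑ m ∈ a.support,
    monomial
      (Finsupp.single 0 (m 0) + Finsupp.single 1 (m 1)
        + Finsupp.single 2 (a.totalDegree - (m 0 + m 1)))
      (coeff m a)

/-- The divisor of zeros (with multiplicities) of a form `A ∈ k[X,Y,Z]`: the multiset of its
prime factors, recorded as a finitely supported `ℤ`-valued function on the irreducible curves
of `ℙ²` (identified with the ideals of `k[X,Y,Z]` spanned by irreducible forms). -/
noncomputable def divPlus {k : Type} [Field k] (A : MvPolynomial (Fin 3) k) :
    Ideal (MvPolynomial (Fin 3) k) →₀ ℤ :=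
  letI := Classical.decEq (Ideal (MvPolynomial (Fin 3) k))
  Finsupp.mapRange Int.ofNat rfl
    (Multiset.toFinsupp
      ((UniqueFactorizationMonoid.factors A).map fun π => Ideal.span {π}))

/-- The divisor `div(f) = Σ_C ord_C(f)·C` on `ℙ²` of a rational function `f ∈ k(x,y)*`:
writing `f = a/b` in lowest terms and `A`, `B` for the homogenizations of `a`, `b`, the
function `f` on `ℙ²` is `(A·Z^(deg b))/(B·Z^(deg a))`, and its divisor is
`div₊(A) - div₊(B) + (deg b - deg a)·l_∞`. -/
noncomputable def divP {k : Type} [Field k] (f : FractionRing (MvPolynomial (Fin 2) k)) :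
    Ideal (MvPolynomial (Fin 3) k) →₀ ℤ :=
  divPlus (homog (IsFractionRing.num (MvPolynomial (Fin 2) k) f))
    - divPlus (homog ((IsFractionRing.den (MvPolynomial (Fin 2) k) f :
        MvPolynomial (Fin 2) k)))
    + (((IsFractionRing.den (MvPolynomial (Fin 2) k) f :
          MvPolynomial (Fin 2) k).totalDegree : ℤ)
        - ((IsFractionRing.num (MvPolynomial (Fin 2) k) f).totalDegree : ℤ))
      • Finsupp.single (Ideal.span {(X 2 : MvPolynomial (Fin 3) k)}) 1

/-- The line `l_∞ = {Z = 0}` of `ℙ²`, as an ideal of `k[X,Y,Z]`. -/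
noncomputable def lInf (k : Type) [Field k] : Ideal (MvPolynomial (Fin 3) k) :=
  Ideal.span {X 2}

/-- The line `l_h = {Y = 0}` of `ℙ²`, as an ideal of `k[X,Y,Z]`. -/
noncomputable def lH (k : Type) [Field k] : Ideal (MvPolynomial (Fin 3) k) :=
  Ideal.span {X 1}

/-- The line `l_v = {X = 0}` of `ℙ²`, as an ideal of `k[X,Y,Z]`. -/
noncomputable def lV (k : Type) [Field k] : Ideal (MvPolynomial (Fin 3) k) :=
  Ideal.span {X 0}

/-- The incidence relation: a point of `ℙ²` lies on the vanishing locus of an ideal of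
`k[X,Y,Z]`. -/
def onCrv {k : Type} [Field k] (pt : P2 k) (I : Ideal (MvPolynomial (Fin 3) k)) : Prop :=
  ∀ G ∈ I, eval pt.rep G = 0

/-- The support `|D⁺|` of the positive part of a divisor `D` on `ℙ²`. -/
def posLocus {k : Type} [Field k] (D : Ideal (MvPolynomial (Fin 3) k) →₀ ℤ) : Set (P2 k) :=
  {pt | ∃ I, 0 < D I ∧ onCrv pt I}

/-- The support `|D⁻|` of the negative part of a divisor `D` on `ℙ²`. -/
def negLocus {k : Type} [Field k] (D : Ideal (MvPolynomial (Fin 3) k) →₀ ℤ) : Set (P2 k) :=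
  {pt | ∃ I, D I < 0 ∧ onCrv pt I}

/-- The indeterminacy (base) locus `Bs(f) = |D⁺| ∩ |D⁻|` of `f : ℙ² ⇢ ℙ¹`, `D = div f`. -/
def Bs {k : Type} [Field k] (f : FractionRing (MvPolynomial (Fin 2) k)) : Set (P2 k) :=
  posLocus (divP f) ∩ negLocus (divP f)

/-- The linear form cut out by the `i`-th row of a matrix `M`, viewed as the rational function
`M_{i0}·x + M_{i1}·y + M_{i2}` on the affine chart `{Z ≠ 0}`. -/
noncomputable def linFrac {k : Type} [Field k] (M : Matrix (Fin 3) (Fin 3) k) (i : Fin 3) :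
    FractionRing (MvPolynomial (Fin 2) k) :=
  algebraMap (MvPolynomial (Fin 2) k) _ (C (M i 0) * X 0 + C (M i 1) * X 1 + C (M i 2))

/-- `φ = (f,g) : ℙ² ⇢ ℙ²` is biregular, i.e. extends to an automorphism of `ℙ²_k`:
since `Aut ℙ² = PGL₃`, this says that `φ` is induced by an invertible linear change of
homogeneous coordinates. -/
def ExtendsToAut {k : Type} [Field k] (f g : FractionRing (MvPolynomial (Fin 2) k)) : Prop :=
  ∃ M : GL (Fin 3) k,
    linFrac (M : Matrix (Fin 3) (Fin 3) k) 2 ≠ 0 ∧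
    f * linFrac (M : Matrix (Fin 3) (Fin 3) k) 2 = linFrac (M : Matrix (Fin 3) (Fin 3) k) 0 ∧
    g * linFrac (M : Matrix (Fin 3) (Fin 3) k) 2 = linFrac (M : Matrix (Fin 3) (Fin 3) k) 1

/-- The affine coordinate ring `k[x,y]` of `𝔸² ⊂ ℙ²` (the chart `Z ≠ 0`, `x = X/Z`,
`y = Y/Z`). -/
abbrev R2 (k : Type) [Field k] : Type := MvPolynomial (Fin 2) k

/-- The field `k(x,y)` of rational functions on `𝔸²` (and on `ℙ²`). -/
abbrev FF (k : Type) [Field k] : Type := FractionRing (MvPolynomial (Fin 2) k)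

/-- The point `0 = [0:0:1] ∈ ℙ²`. -/
noncomputable def pt0 (k : Type) [Field k] : P2 k :=
  Projectivization.mk k ![0, 0, 1] (by intro h; have := congrFun h 2; simp at this)

/-- The point `∞_h = [1:0:0] ∈ ℙ²`. -/
noncomputable def ptH (k : Type) [Field k] : P2 k :=
  Projectivization.mk k ![1, 0, 0] (by intro h; have := congrFun h 0; simp at this)

/-- The point `∞_v = [0:1:0] ∈ ℙ²`. -/
noncomputable def ptV (k : Type) [Field k] : P2 k :=
  Projectivization.mk k ![0, 1, 0] (by intro h; have := congrFun h 1; simp at this)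

/-- A factor of a nonzero homogeneous polynomial over a domain is homogeneous. -/
theorem exists_isHomogeneous_of_dvd {σ R : Type*} [CommRing R] [IsDomain R]
    {P H : MvPolynomial σ R} {n : ℕ} (hH : H.IsHomogeneous n) (hH0 : H ≠ 0) (hPH : P ∣ H) :
    ∃ m, P.IsHomogeneous m := by
  obtain ⟨Q, rfl⟩ := hPH
  let φ : MvPolynomial σ R →ₐ[R] Polynomial (MvPolynomial σ R) :=
    aeval fun i => Polynomial.X * Polynomial.C (X i)
  have hφhom : ∀ (F : MvPolynomial σ R) (d : ℕ), F.IsHomogeneous d →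
      φ F = Polynomial.monomial d F := by
    intro F d hF
    conv_lhs => rw [F.as_sum, map_sum]
    conv_rhs => rw [F.as_sum, map_sum]
    refine Finset.sum_congr rfl fun m hm => ?_
    have hd : ∑ i ∈ m.support, m i = d := by
      rw [← Finsupp.degree_apply, Finsupp.degree_eq_weight_one]; exact hF (mem_support_iff.mp hm)
    rw [aeval_monomial, ← Polynomial.C_mul_X_pow_eq_monomial, monomial_eq, ← hd]
    simp only [Finsupp.prod, mul_pow, Finset.prod_mul_distrib, Finset.prod_pow_eq_pow_sum,
      Polynomial.C_mul, map_prod, Polynomial.C_pow]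
    rw [IsScalarTower.algebraMap_apply R (MvPolynomial σ R) (Polynomial (MvPolynomial σ R))]
    simp only [Polynomial.algebraMap_eq, MvPolynomial.algebraMap_eq]
    ring
  have hcoeff : ∀ (F : MvPolynomial σ R) (i : ℕ),
      (φ F).coeff i = homogeneousComponent i F := by
    intro F i
    conv_lhs => rw [← sum_homogeneousComponent F]
    rw [map_sum, Polynomial.finsetSum_coeff]
    simp only [hφhom _ _ (homogeneousComponent_isHomogeneous _ F), Polynomial.coeff_monomial]
    rw [Finset.sum_ite_eq']
    split_ifs with h
    · rfl
    · rw [homogeneousComponent_eq_zero]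
      simpa using h
  have hinj : ∀ F : MvPolynomial σ R, F ≠ 0 → φ F ≠ 0 := by
    intro F hF h
    apply hF
    rw [← sum_homogeneousComponent F]
    refine Finset.sum_eq_zero fun i _ => ?_
    rw [← hcoeff, h, Polynomial.coeff_zero]
  have hP := hinj P (left_ne_zero_of_mul hH0)
  have hQ := hinj Q (right_ne_zero_of_mul hH0)
  have hdeg : (φ P).natDegree + (φ Q).natDegree = n := by
    rw [← Polynomial.natDegree_mul hP hQ, ← map_mul, hφhom _ _ hH,
      Polynomial.natDegree_monomial_eq _ hH0]
  have htr : (φ P).natTrailingDegree + (φ Q).natTrailingDegree = n := by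
    rw [← Polynomial.natTrailingDegree_mul hP hQ, ← map_mul, hφhom _ _ hH,
      Polynomial.natTrailingDegree_monomial hH0]
  have h1 := (φ P).natTrailingDegree_le_natDegree
  have h2 := (φ Q).natTrailingDegree_le_natDegree
  have hPc : P = homogeneousComponent (φ P).natDegree P := by
    conv_lhs => rw [← sum_homogeneousComponent P]
    rw [Finset.sum_eq_single (φ P).natDegree]
    · intro i _ hi
      rw [← hcoeff]
      rcases lt_or_gt_of_ne hi with h | h
      · exact Polynomial.coeff_eq_zero_of_lt_natTrailingDegree (by omega)
      · exact Polynomial.coeff_eq_zero_of_natDegree_lt h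
    · intro h
      exact homogeneousComponent_eq_zero _ _ (by simpa using h)
  generalize (φ P).natDegree = d at hPc
  refine ⟨d, ?_⟩
  rw [hPc]
  exact homogeneousComponent_isHomogeneous _ _

/-- A homogeneous polynomial of degree `n` satisfies `P(t v) = t ^ n P(v)`. -/
theorem eval_smul_of_isHomogeneous {σ R : Type*} [CommRing R]
    {P : MvPolynomial σ R} {n : ℕ} (hP : P.IsHomogeneous n) (t : R) (v : σ → R) :
    eval (t • v) P = t ^ n * eval v P := by
  rw [eval_eq, eval_eq, Finset.mul_sum]
  refine Finset.sum_congr rfl fun m hm => ?_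
  have hd : ∑ i ∈ m.support, m i = n := by
    rw [← Finsupp.degree_apply, Finsupp.degree_eq_weight_one]; exact hP (mem_support_iff.mp hm)
  rw [← hd]
  simp only [Pi.smul_apply, smul_eq_mul, mul_pow, Finset.prod_mul_distrib,
    Finset.prod_pow_eq_pow_sum]
  ring

section Dehomogenization

variable {k : Type} [Field k]

/-- Dehomogenization `k[X,Y,Z] → k[x,y]`, sending `Z` to `1`. -/
noncomputable def dehom (k : Type) [Field k] : MvPolynomial (Fin 3) k →ₐ[k] R2 k :=
  aeval ![X 0, X 1, 1]

theorem dehom_X_castSucc (i : Fin 2) : dehom k (X i.castSucc) = X i := by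
  fin_cases i <;> simp [dehom]

theorem dehom_X_two : dehom k (X 2) = 1 := by
  simp [dehom]

theorem dehom_homog (a : R2 k) : dehom k (homog a) = a := by
  conv_rhs => rw [a.as_sum]
  rw [homog, map_sum]
  refine Finset.sum_congr rfl fun m _ => ?_
  rw [monomial_eq, monomial_eq, Finsupp.prod_fintype _ _ (by simp),
    Finsupp.prod_fintype _ _ (by simp)]
  simp [dehom, Fin.prod_univ_succ, Finsupp.single_apply]

theorem homog_isHomogeneous (a : R2 k) : (homog a).IsHomogeneous a.totalDegree := by
  refine IsHomogeneous.sum _ _ _ fun m hm => isHomogeneous_monomial _ ?_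
  have h := le_totalDegree hm
  rw [Finsupp.sum_fintype _ _ (by simp), Fin.sum_univ_two] at h
  simp only [map_add, Finsupp.degree_single]
  omega

theorem homog_ne_zero {a : R2 k} (ha : a ≠ 0) : homog a ≠ 0 := by
  intro h
  apply ha
  rw [← dehom_homog a, h, map_zero]

theorem eval_dehom (P : MvPolynomial (Fin 3) k) (u : Fin 2 → k) :
    eval u (dehom k P) = eval ![u 0, u 1, 1] P := by
  induction P using MvPolynomial.induction_on with
  | C a => simp [dehom]
  | add p q hp hq => simp [hp, hq]
  | mul_X p i hp =>
    rw [map_mul, map_mul, map_mul, hp]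
    congr 1
    fin_cases i <;> simp [dehom]

theorem eq_zero_of_dehom_eq_zero [Infinite k] {P : MvPolynomial (Fin 3) k} {n : ℕ}
    (hP : P.IsHomogeneous n) (h : dehom k P = 0) : P = 0 := by
  suffices hZ : X 2 * P = 0 from (mul_eq_zero.mp hZ).resolve_left (X_ne_zero 2)
  apply MvPolynomial.funext
  intro v
  rw [map_mul, eval_X, map_zero]
  by_cases hv : v 2 = 0
  · rw [hv, zero_mul]
  · have hvs : v = v 2 • ![v 0 / v 2, v 1 / v 2, 1] := by
      ext i
      fin_cases i <;> simp <;> field_simp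
    have h0 := eval_dehom P ![v 0 / v 2, v 1 / v 2]
    rw [h, map_zero] at h0
    rw [hvs, eval_smul_of_isHomogeneous hP]
    simp only [Matrix.cons_val_zero, Matrix.cons_val_one] at h0
    rw [← h0]
    simp

theorem mul_X_pow_eq_of_dehom_eq [Infinite k] {P Q : MvPolynomial (Fin 3) k} {n m : ℕ}
    (hP : P.IsHomogeneous n) (hQ : Q.IsHomogeneous m) (h : dehom k P = dehom k Q) :
    P * X 2 ^ m = Q * X 2 ^ n := by
  rw [← sub_eq_zero]
  have h1 : (P * X 2 ^ m).IsHomogeneous (n + m) := hP.mul (isHomogeneous_X_pow 2 m)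
  have h2 : (Q * X 2 ^ n).IsHomogeneous (n + m) := by
    rw [add_comm]
    exact hQ.mul (isHomogeneous_X_pow 2 n)
  refine eq_zero_of_dehom_eq_zero (h1.sub h2) ?_
  simp [dehom_X_two, h]

/-- A prime form `π` other than `Z` divides a form `H` iff its dehomogenization divides that
of `H`. -/
theorem dvd_iff_dehom_dvd [Infinite k] {π H : MvPolynomial (Fin 3) k} (hπ : Prime π) {n m : ℕ}
    (hn : π.IsHomogeneous n) (hm : H.IsHomogeneous m) (hZ : ¬ π ∣ X 2) :
    π ∣ H ↔ dehom k π ∣ dehom k H := by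
  refine ⟨map_dvd (dehom k), ?_⟩
  rintro ⟨e, he⟩
  have h := mul_X_pow_eq_of_dehom_eq hm (hn.mul (homog_isHomogeneous e))
    (by rw [he, map_mul, dehom_homog])
  have h1 : π ∣ H * X 2 ^ (n + e.totalDegree) := by
    rw [h, mul_assoc]
    exact dvd_mul_right _ _
  exact (hπ.dvd_or_dvd h1).resolve_right fun h2 => hZ (hπ.dvd_of_dvd_pow h2)

theorem dvd_homog_iff [Infinite k] {π : MvPolynomial (Fin 3) k} (hπ : Prime π) {n : ℕ}
    (hn : π.IsHomogeneous n) (hZ : ¬ π ∣ X 2) (a : R2 k) :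
    π ∣ homog a ↔ dehom k π ∣ a := by
  rw [dvd_iff_dehom_dvd hπ hn (homog_isHomogeneous a) hZ, dehom_homog]

theorem not_dvd_X_two {π : MvPolynomial (Fin 3) k} (hu : ¬ IsUnit (dehom k π)) : ¬ π ∣ X 2 :=
  fun h => hu (isUnit_of_dvd_one (by simpa [dehom_X_two] using map_dvd (dehom k) h))

theorem prime_dehom [Infinite k] {π : MvPolynomial (Fin 3) k} (hπ : Prime π) {n : ℕ}
    (hn : π.IsHomogeneous n) (hu : ¬ IsUnit (dehom k π)) :
    Prime (dehom k π) := by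
  have hZ := not_dvd_X_two hu
  have h0 : dehom k π ≠ 0 := fun h => hπ.ne_zero (eq_zero_of_dehom_eq_zero hn h)
  refine ⟨h0, hu, fun u v huv => ?_⟩
  by_cases hu0 : u = 0
  · exact Or.inl (hu0 ▸ dvd_zero _)
  by_cases hv0 : v = 0
  · exact Or.inr (hv0 ▸ dvd_zero _)
  rw [← dvd_homog_iff hπ hn hZ] at huv
  have h := mul_X_pow_eq_of_dehom_eq (homog_isHomogeneous (u * v))
    ((homog_isHomogeneous u).mul (homog_isHomogeneous v)) (by simp [dehom_homog])
  have h1 : π ∣ homog u * homog v * X 2 ^ (u * v).totalDegree := by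
    rw [← h]
    exact huv.mul_right _
  rw [← dvd_homog_iff hπ hn hZ, ← dvd_homog_iff hπ hn hZ]
  exact hπ.dvd_or_dvd ((hπ.dvd_or_dvd h1).resolve_right fun h2 => hZ (hπ.dvd_of_dvd_pow h2))

end Dehomogenization

section Divisors

variable {k : Type} [Field k]

theorem divPlus_span_pos_iff {A π : MvPolynomial (Fin 3) k} (hA : A ≠ 0) (hπ : Prime π) :
    0 < divPlus A (Ideal.span {π}) ↔ π ∣ A := by
  classical
  simp only [divPlus, Finsupp.mapRange_apply, Multiset.toFinsupp_apply, Int.ofNat_eq_natCast,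
    Nat.cast_pos, Multiset.count_pos, Multiset.mem_map]
  constructor
  · rintro ⟨ρ, hρ, h⟩
    rw [Ideal.span_singleton_eq_span_singleton] at h
    exact h.symm.dvd.trans (UniqueFactorizationMonoid.dvd_of_mem_factors hρ)
  · intro h
    obtain ⟨ρ, hρ, h⟩ := UniqueFactorizationMonoid.exists_mem_factors_of_dvd hA hπ.irreducible h
    exact ⟨ρ, hρ, Ideal.span_singleton_eq_span_singleton.mpr h.symm⟩

theorem divPlus_nonneg (A : MvPolynomial (Fin 3) k) (I : Ideal (MvPolynomial (Fin 3) k)) :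
    0 ≤ divPlus A I := by
  simp [divPlus]

theorem exists_prime_of_divPlus_ne_zero {A : MvPolynomial (Fin 3) k}
    {I : Ideal (MvPolynomial (Fin 3) k)} (h : divPlus A I ≠ 0) :
    ∃ π, Prime π ∧ π ∣ A ∧ I = Ideal.span {π} := by
  classical
  simp only [divPlus, Finsupp.mapRange_apply, Multiset.toFinsupp_apply, Int.ofNat_eq_natCast,
    ne_eq, Nat.cast_eq_zero, Multiset.count_eq_zero, Multiset.mem_map, not_not] at h
  obtain ⟨π, hπ, rfl⟩ := h
  exact ⟨π, UniqueFactorizationMonoid.prime_of_factor π hπ,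
    UniqueFactorizationMonoid.dvd_of_mem_factors hπ, rfl⟩

/-- The numerator of a rational function in lowest terms. -/
noncomputable abbrev fnum (f : FF k) : R2 k := IsFractionRing.num (R2 k) f

/-- The denominator of a rational function in lowest terms. -/
noncomputable abbrev fden (f : FF k) : R2 k := (IsFractionRing.den (R2 k) f : R2 k)

theorem fden_ne_zero (f : FF k) : fden f ≠ 0 :=
  nonZeroDivisors.ne_zero (IsFractionRing.den (R2 k) f).2

theorem fnum_ne_zero (f : (FF k)ˣ) : fnum (f : FF k) ≠ 0 := by
  rw [fnum, Ne, IsFractionRing.num_eq_zero]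
  exact f.ne_zero

theorem not_dvd_fnum_and_fden {q : R2 k} (hq : ¬ IsUnit q) (f : FF k) :
    ¬ (q ∣ fnum f ∧ q ∣ fden f) :=
  fun h => hq (IsFractionRing.num_den_reduced (R2 k) f h.1 h.2)

theorem divP_apply (f : FF k) {I : Ideal (MvPolynomial (Fin 3) k)} (hI : I ≠ lInf k) :
    divP f I = divPlus (homog (fnum f)) I - divPlus (homog (fden f)) I := by
  have : Ideal.span {X 2} ≠ I := fun h => hI h.symm
  simp [divP, this]

theorem span_ne_lInf {π : MvPolynomial (Fin 3) k} (hu : ¬ IsUnit (dehom k π)) :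
    Ideal.span {π} ≠ lInf k := by
  intro h
  rw [lInf, Ideal.span_singleton_eq_span_singleton] at h
  exact not_dvd_X_two hu h.dvd

theorem divP_span_pos_iff (f : (FF k)ˣ) {π : MvPolynomial (Fin 3) k} (hπ : Prime π)
    (hu : ¬ IsUnit (dehom k π)) :
    0 < divP (f : FF k) (Ideal.span {π}) ↔ π ∣ homog (fnum (f : FF k)) := by
  have h1 := divPlus_span_pos_iff (homog_ne_zero (fnum_ne_zero f)) hπ
  have h2 := divPlus_span_pos_iff (homog_ne_zero (fden_ne_zero (f : FF k))) hπ
  have h3 := divPlus_nonneg (homog (fnum (f : FF k))) (Ideal.span {π})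
  have h4 := divPlus_nonneg (homog (fden (f : FF k))) (Ideal.span {π})
  have h5 : ¬ (π ∣ homog (fnum (f : FF k)) ∧ π ∣ homog (fden (f : FF k))) := fun h =>
    not_dvd_fnum_and_fden hu (f : FF k) ⟨by simpa [dehom_homog] using map_dvd (dehom k) h.1,
      by simpa [dehom_homog] using map_dvd (dehom k) h.2⟩
  rw [divP_apply _ (span_ne_lInf hu), ← h1]
  rw [← h1, ← h2] at h5
  omega

theorem divP_span_neg_iff (f : (FF k)ˣ) {π : MvPolynomial (Fin 3) k} (hπ : Prime π)
    (hu : ¬ IsUnit (dehom k π)) :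
    divP (f : FF k) (Ideal.span {π}) < 0 ↔ π ∣ homog (fden (f : FF k)) := by
  have h1 := divPlus_span_pos_iff (homog_ne_zero (fnum_ne_zero f)) hπ
  have h2 := divPlus_span_pos_iff (homog_ne_zero (fden_ne_zero (f : FF k))) hπ
  have h3 := divPlus_nonneg (homog (fnum (f : FF k))) (Ideal.span {π})
  have h4 := divPlus_nonneg (homog (fden (f : FF k))) (Ideal.span {π})
  have h5 : ¬ (π ∣ homog (fnum (f : FF k)) ∧ π ∣ homog (fden (f : FF k))) := fun h =>
    not_dvd_fnum_and_fden hu (f : FF k) ⟨by simpa [dehom_homog] using map_dvd (dehom k) h.1,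
      by simpa [dehom_homog] using map_dvd (dehom k) h.2⟩
  rw [divP_apply _ (span_ne_lInf hu), ← h2]
  rw [← h1, ← h2] at h5
  omega

/-- A prime form `π` is a component of `div f` iff its dehomogenization divides the numerator
or the denominator of `f`. -/
theorem divP_span_ne_zero_iff [Infinite k] (f : (FF k)ˣ) {π : MvPolynomial (Fin 3) k}
    (hπ : Prime π) {n : ℕ} (hn : π.IsHomogeneous n) (hu : ¬ IsUnit (dehom k π)) :
    divP (f : FF k) (Ideal.span {π}) ≠ 0 ↔
      dehom k π ∣ fnum (f : FF k) ∨ dehom k π ∣ fden (f : FF k) := by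
  have hZ := not_dvd_X_two hu
  rw [← dvd_homog_iff hπ hn hZ, ← dvd_homog_iff hπ hn hZ, ← divP_span_pos_iff f hπ hu,
    ← divP_span_neg_iff f hπ hu]
  omega

theorem onCrv_pt0_span_iff {π : MvPolynomial (Fin 3) k} {n : ℕ} (hn : π.IsHomogeneous n) :
    onCrv (pt0 k) (Ideal.span {π}) ↔ eval 0 (dehom k π) = 0 := by
  obtain ⟨t, ht⟩ := Projectivization.exists_smul_eq_mk_rep k (![0, 0, 1] : Fin 3 → k)
    (by intro h; have := congrFun h 2; simp at this)
  have hrep : (pt0 k).rep = (t : k) • ![0, 0, 1] := ht.symm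
  have h0 : eval (pt0 k).rep π = 0 ↔ eval 0 (dehom k π) = 0 := by
    rw [hrep, eval_smul_of_isHomogeneous hn, eval_dehom]
    simp
  rw [← h0]
  constructor
  · intro h
    exact h π (Ideal.mem_span_singleton_self π)
  · intro h G hG
    obtain ⟨c, rfl⟩ := Ideal.mem_span_singleton.mp hG
    rw [map_mul, h, zero_mul]

theorem not_isUnit_of_eval_eq_zero {q : R2 k} {v : Fin 2 → k} (h : eval v q = 0) :
    ¬ IsUnit q := by
  intro hq
  have := hq.map (eval v)
  rw [h] at this
  exact not_isUnit_zero this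

theorem exists_prime_dvd_homog {a : R2 k} (ha : a ≠ 0) (h : eval 0 a = 0) :
    ∃ π, Prime π ∧ π ∣ homog a ∧ eval 0 (dehom k π) = 0 := by
  obtain ⟨s, hs, u, hu⟩ := UniqueFactorizationMonoid.exists_prime_factors _ (homog_ne_zero ha)
  have h1 : (s.map fun π => eval 0 (dehom k π)).prod * eval 0 (dehom k u) = 0 := by
    rw [← h]
    conv_rhs => rw [← dehom_homog a, ← hu]
    rw [map_mul, map_mul, map_multiset_prod, map_multiset_prod, Multiset.map_map]
    rfl
  rw [mul_eq_zero] at h1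
  rcases h1 with h1 | h1
  · rw [Multiset.prod_eq_zero_iff, Multiset.mem_map] at h1
    obtain ⟨π, hπ, h2⟩ := h1
    exact ⟨π, hs π hπ, (Multiset.dvd_prod hπ).trans (hu ▸ dvd_mul_right _ _), h2⟩
  · exact absurd (u.isUnit.map (dehom k)) (not_isUnit_of_eval_eq_zero h1)

theorem pt0_mem_posLocus (f : (FF k)ˣ) (h : eval 0 (fnum (f : FF k)) = 0) :
    pt0 k ∈ posLocus (divP (f : FF k)) := by
  obtain ⟨π, hπ, hd, h0⟩ := exists_prime_dvd_homog (fnum_ne_zero f) h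
  obtain ⟨n, hn⟩ := exists_isHomogeneous_of_dvd (homog_isHomogeneous _)
    (homog_ne_zero (fnum_ne_zero f)) hd
  exact ⟨_, (divP_span_pos_iff f hπ (not_isUnit_of_eval_eq_zero h0)).mpr hd,
    (onCrv_pt0_span_iff hn).mpr h0⟩

theorem pt0_mem_negLocus (f : (FF k)ˣ) (h : eval 0 (fden (f : FF k)) = 0) :
    pt0 k ∈ negLocus (divP (f : FF k)) := by
  obtain ⟨π, hπ, hd, h0⟩ := exists_prime_dvd_homog (fden_ne_zero (f : FF k)) h
  obtain ⟨n, hn⟩ := exists_isHomogeneous_of_dvd (homog_isHomogeneous _)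
    (homog_ne_zero (fden_ne_zero (f : FF k))) hd
  exact ⟨_, (divP_span_neg_iff f hπ (not_isUnit_of_eval_eq_zero h0)).mpr hd,
    (onCrv_pt0_span_iff hn).mpr h0⟩

theorem lInf_not_onCrv_pt0 : ¬ onCrv (pt0 k) (lInf k) := by
  rw [lInf, onCrv_pt0_span_iff (isHomogeneous_X k 2), dehom_X_two]
  simp

/-- Every component of `div f` through the origin is the span of a prime form. -/
theorem exists_prime_form_of_divP_ne_zero (f : (FF k)ˣ) {I : Ideal (MvPolynomial (Fin 3) k)}
    (hI : divP (f : FF k) I ≠ 0) (h0 : onCrv (pt0 k) I) :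
    ∃ (π : MvPolynomial (Fin 3) k) (n : ℕ), Prime π ∧ π.IsHomogeneous n ∧
      eval 0 (dehom k π) = 0 ∧ I = Ideal.span {π} := by
  have hinf : I ≠ lInf k := fun h => lInf_not_onCrv_pt0 (h ▸ h0)
  rw [divP_apply _ hinf] at hI
  have key : ∀ a : R2 k, a ≠ 0 → divPlus (homog a) I ≠ 0 →
      ∃ (π : MvPolynomial (Fin 3) k) (n : ℕ), Prime π ∧ π.IsHomogeneous n ∧
      eval 0 (dehom k π) = 0 ∧ I = Ideal.span {π} := by
    intro a ha h
    obtain ⟨π, hπ, hd, rfl⟩ := exists_prime_of_divPlus_ne_zero h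
    obtain ⟨n, hn⟩ := exists_isHomogeneous_of_dvd (homog_isHomogeneous _) (homog_ne_zero ha) hd
    exact ⟨π, n, hπ, hn, (onCrv_pt0_span_iff hn).mp h0, rfl⟩
  by_cases h : divPlus (homog (fnum (f : FF k))) I = 0
  · exact key _ (fden_ne_zero (f : FF k)) fun h' => hI (by rw [h, h', sub_zero])
  · exact key _ (fnum_ne_zero f) h

end Divisors

section TameSymbols

variable {k : Type} [Field k]

/-- The height-one prime generated by a prime element. -/
noncomputable def primeH1 (q : R2 k) (hq : Prime q) : H1 (R2 k) :=
  ⟨⟨Ideal.span {q}, (Ideal.span_singleton_prime hq.ne_zero).mpr hq⟩, by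
    rw [← PrimeSpectrum.height_eq_orderHeight]
    exact Ideal.height_span_singleton_eq_one_of_mem_nonZeroDivisors
      (mem_nonZeroDivisors_of_ne_zero hq.ne_zero) hq.not_isUnit⟩

theorem mem_primeH1 {q : R2 k} (hq : Prime q) (a : R2 k) :
    a ∈ (primeH1 q hq).1.asIdeal ↔ q ∣ a :=
  Ideal.mem_span_singleton

theorem symbPow_zero {R : Type} [CommRing R] (p : PrimeSpectrum R) : symbPow p 0 = ⊤ := by
  simp [symbPow, Ideal.one_eq_top]

theorem symbPow_one {R : Type} [CommRing R] (p : PrimeSpectrum R) :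
    symbPow p 1 = p.asIdeal := by
  rw [symbPow, pow_one, Localization.AtPrime.map_eq_maximalIdeal]
  exact Localization.AtPrime.under_maximalIdeal

theorem notMem_symbPow_two {q : R2 k} (hq : Prime q) : q ∉ symbPow (primeH1 q hq).1 2 := by
  intro h
  set p := (primeH1 q hq).1
  have hmap : Ideal.map (algebraMap (R2 k) (Localization.AtPrime p.asIdeal)) p.asIdeal =
      Ideal.span {algebraMap (R2 k) (Localization.AtPrime p.asIdeal) q} := by
    change Ideal.map _ (Ideal.span {q}) = _
    rw [Ideal.map_span, Set.image_singleton]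
  rw [symbPow, Ideal.mem_comap, hmap, Ideal.span_singleton_pow, Ideal.mem_span_singleton] at h
  obtain ⟨s, hs⟩ := h
  have hinj : Function.Injective (algebraMap (R2 k) (Localization.AtPrime p.asIdeal)) :=
    IsLocalization.injective _ p.asIdeal.primeCompl_le_nonZeroDivisors
  have h0 : algebraMap (R2 k) (Localization.AtPrime p.asIdeal) q ≠ 0 := by
    rw [Ne, map_eq_zero_iff _ hinj]
    exact hq.ne_zero
  have : IsDomain (Localization.AtPrime p.asIdeal) :=
    IsLocalization.isDomain_localization p.asIdeal.primeCompl_le_nonZeroDivisors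
  have h1 : algebraMap (R2 k) (Localization.AtPrime p.asIdeal) q * s = 1 :=
    mul_left_cancel₀ h0 (by rw [mul_one, ← mul_assoc, ← sq]; exact hs.symm)
  have h2 := (IsLocalization.AtPrime.isUnit_to_map_iff (Localization.AtPrime p.asIdeal)
    p.asIdeal q).mp (IsUnit.of_mul_eq_one _ h1)
  exact h2 (Ideal.mem_span_singleton_self q)

/-- `ν` is the family of discrete valuations attached to the height-one primes of `k[x,y]`. -/
structure IsValFamily (ν : H1 (R2 k) → (FF k)ˣ → ℤ) : Prop where
  map_mul : ∀ p f g, ν p (f * g) = ν p f + ν p g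
  char : ∀ (p : H1 (R2 k)) (a : R2 k) (u : (FF k)ˣ),
    (u : FF k) = algebraMap (R2 k) (FF k) a →
    ∀ m : ℕ, (ν p u = m ↔ a ∈ symbPow p.1 m ∧ a ∉ symbPow p.1 (m + 1))

variable {ν : H1 (R2 k) → (FF k)ˣ → ℤ}

theorem IsValFamily.eq_zero_iff (hν : IsValFamily ν) {q a : R2 k} (hq : Prime q) {u : (FF k)ˣ}
    (hu : (u : FF k) = algebraMap (R2 k) (FF k) a) :
    ν (primeH1 q hq) u = 0 ↔ ¬ q ∣ a := by
  have h := hν.char (primeH1 q hq) a u hu 0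
  rw [Nat.cast_zero] at h
  rw [h, symbPow_zero, zero_add, symbPow_one, mem_primeH1]
  simp

theorem IsValFamily.eq_one (hν : IsValFamily ν) {q : R2 k} (hq : Prime q) {u : (FF k)ˣ}
    (hu : (u : FF k) = algebraMap (R2 k) (FF k) q) :
    ν (primeH1 q hq) u = 1 := by
  have h := hν.char (primeH1 q hq) q u hu 1
  rw [Nat.cast_one] at h
  rw [h, symbPow_one, mem_primeH1]
  exact ⟨dvd_rfl, notMem_symbPow_two hq⟩

theorem eq_fnum_div_fden (f : FF k) :
    f = algebraMap (R2 k) (FF k) (fnum f) / algebraMap (R2 k) (FF k) (fden f) :=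
  (IsFractionRing.mk'_num_den' (R2 k) f).symm

/-- The valuation of `f` at `q` vanishes iff `q` divides neither the numerator nor the
denominator of `f`. -/
theorem IsValFamily.eq_zero_iff_fnum_fden (hν : IsValFamily ν) {q : R2 k} (hq : Prime q)
    (f : (FF k)ˣ) :
    ν (primeH1 q hq) f = 0 ↔ ¬ (q ∣ fnum (f : FF k) ∨ q ∣ fden (f : FF k)) := by
  have hinj := IsFractionRing.injective (R2 k) (FF k)
  have hn : algebraMap (R2 k) (FF k) (fnum (f : FF k)) ≠ 0 := by
    rw [Ne, map_eq_zero_iff _ hinj]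
    exact fnum_ne_zero f
  have hd : algebraMap (R2 k) (FF k) (fden (f : FF k)) ≠ 0 := by
    rw [Ne, map_eq_zero_iff _ hinj]
    exact fden_ne_zero _
  have hfac : f * Units.mk0 _ hd = Units.mk0 _ hn := by
    ext
    exact (eq_div_iff hd).mp (eq_fnum_div_fden (f : FF k))
  have hval := hν.map_mul (primeH1 q hq) f (Units.mk0 _ hd)
  rw [hfac] at hval
  have h1 := hν.eq_zero_iff hq (Units.val_mk0 hn)
  have h2 := hν.eq_zero_iff hq (Units.val_mk0 hd)
  have h3 := not_dvd_fnum_and_fden hq.not_isUnit (f : FF k)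
  by_cases ha : q ∣ fnum (f : FF k) <;> by_cases hb : q ∣ fden (f : FF k) <;>
    simp only [ha, hb, not_true, not_false_iff, iff_true, iff_false, and_self, or_self, or_true,
      true_or] at h1 h2 h3 ⊢ <;> omega

/-- The unit of the local ring at `p` whose residue class is the tame symbol of `f` and `g`. -/
noncomputable def tameRatio (ν : H1 (R2 k) → (FF k)ˣ → ℤ) (p : H1 (R2 k)) (f g : (FF k)ˣ) :
    FF k :=
  (-1 : FF k) ^ (ν p f * ν p g) * (g : FF k) ^ (ν p f) * (f : FF k) ^ (-(ν p g))

theorem tameRatio_swap (p : H1 (R2 k)) (f g : (FF k)ˣ) :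
    tameRatio ν p g f = (tameRatio ν p f g)⁻¹ := by
  have h1 : ((-1 : FF k) ^ (ν p f * ν p g))⁻¹ = (-1 : FF k) ^ (ν p f * ν p g) := by
    rw [← inv_zpow, inv_neg, inv_one]
  rw [tameRatio, tameRatio, mul_inv, mul_inv, h1, zpow_neg, zpow_neg, inv_inv, mul_comm (ν p g)]
  ring

/-- The tame symbols of `{f, g}` and `{x, y}` agree up to constants at all height-one primes,
expressed in terms of fractions representing them. -/
def TameAgree (ν : H1 (R2 k) → (FF k)ˣ → ℤ) (f g x y : (FF k)ˣ) : Prop :=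
  ∀ (p : H1 (R2 k)) (A S A' S' : R2 k), A ∉ p.1.asIdeal → S ∉ p.1.asIdeal →
    A' ∉ p.1.asIdeal → S' ∉ p.1.asIdeal →
    tameRatio ν p f g = algebraMap (R2 k) (FF k) A / algebraMap (R2 k) (FF k) S →
    tameRatio ν p x y = algebraMap (R2 k) (FF k) A' / algebraMap (R2 k) (FF k) S' →
    ∃ c : k, c ≠ 0 ∧ A * S' - C c * A' * S ∈ p.1.asIdeal

theorem TameAgree.swap {f g x y : (FF k)ˣ} (h : TameAgree ν f g x y) :
    TameAgree ν g f y x := by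
  intro p A S A' S' hA hS hA' hS' h1 h2
  rw [tameRatio_swap, inv_eq_iff_eq_inv, inv_div] at h1 h2
  obtain ⟨c, hc, hmem⟩ := h p S A S' A' hS hA hS' hA' h1 h2
  refine ⟨c⁻¹, inv_ne_zero hc, ?_⟩
  have h3 : A * S' - C c⁻¹ * A' * S = -C c⁻¹ * (S * A' - C c * S' * A) := by
    have : (C c⁻¹ * C c : R2 k) = 1 := by rw [← C_mul, inv_mul_cancel₀ hc, C_1]
    linear_combination (-(A * S')) * this
  rw [h3]
  exact Ideal.mul_mem_left _ _ hmem

theorem resid_eq_zero_iff {R : Type} [CommRing R] (p : PrimeSpectrum R) (r : R) :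
    resid p r = 0 ↔ r ∈ p.asIdeal := by
  rw [resid, map_eq_zero_iff _ (IsFractionRing.injective (R ⧸ p.asIdeal) (kappa p)),
    Ideal.Quotient.eq_zero_iff_mem]

theorem tameAgree_of_tameAt {f g x y : (FF k)ˣ}
    (tameAt : ∀ p : H1 (R2 k), MilnorK2 (FF k) →+ Additive (kappa p.1)ˣ)
    (htameAt : ∀ (p : H1 (R2 k)) (f g : (FF k)ˣ) (a s : R2 k),
      a ∉ p.1.asIdeal → s ∉ p.1.asIdeal →
      ((-1 : FF k) ^ (ν p f * ν p g) * (g : FF k) ^ (ν p f) * (f : FF k) ^ (-(ν p g))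
        = algebraMap (R2 k) (FF k) a / algebraMap (R2 k) (FF k) s) →
      ∀ u : (kappa p.1)ˣ, (u : kappa p.1) * resid p.1 s = resid p.1 a →
        tameAt p (MilnorK2.symbol f g) = Additive.ofMul u)
    (hagree : ∀ p : H1 (R2 k), ∃ c : kˣ,
      tameAt p (MilnorK2.symbol f g) = tameAt p (MilnorK2.symbol x y)
        + Additive.ofMul (Units.map (algebraMap k (kappa p.1)).toMonoidHom c)) :
    TameAgree ν f g x y := by
  intro p A S A' S' hA hS hA' hS' h1 h2
  obtain ⟨c, hc⟩ := hagree p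
  have hne : ∀ r : R2 k, r ∉ p.1.asIdeal → resid p.1 r ≠ 0 := fun r hr h =>
    hr ((resid_eq_zero_iff p.1 r).mp h)
  have e1 := htameAt p f g A S hA hS h1
    (Units.mk0 (resid p.1 A / resid p.1 S) (div_ne_zero (hne A hA) (hne S hS)))
    (div_mul_cancel₀ _ (hne S hS))
  have e2 := htameAt p x y A' S' hA' hS' h2
    (Units.mk0 (resid p.1 A' / resid p.1 S') (div_ne_zero (hne A' hA') (hne S' hS')))
    (div_mul_cancel₀ _ (hne S' hS'))
  rw [e1, e2, ← ofMul_mul, Additive.ofMul.apply_eq_iff_eq, Units.ext_iff] at hc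
  have hcc : algebraMap k (kappa p.1) (c : k) = resid p.1 (C (c : k)) := rfl
  have hc' : resid p.1 A / resid p.1 S =
      resid p.1 A' / resid p.1 S' * resid p.1 (C (c : k)) := hc
  rw [div_eq_iff (hne S hS), div_mul_eq_mul_div, div_mul_eq_mul_div, eq_div_iff (hne S' hS')]
    at hc'
  refine ⟨c, c.ne_zero, ?_⟩
  rw [← resid_eq_zero_iff]
  simp only [resid, map_sub, map_mul] at hc' ⊢
  rw [hc']
  ring

end TameSymbols

section Components

variable {k : Type} [Field k] {ν : H1 (R2 k) → (FF k)ˣ → ℤ}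

/-- A nonzero power of `f` is a quotient of a common positive power of the numerator and
denominator of `f`, in one of the two orders. -/
theorem exists_zpow_eq_div (f : FF k) {e : ℤ} (he : e ≠ 0) :
    ∃ α β N, ((α = fnum f ∧ β = fden f) ∨ (α = fden f ∧ β = fnum f)) ∧
      f ^ e = algebraMap (R2 k) (FF k) (α ^ (N + 1)) /
        algebraMap (R2 k) (FF k) (β ^ (N + 1)) := by
  obtain ⟨N, hN⟩ : ∃ N : ℕ, e.natAbs = N + 1 := ⟨e.natAbs - 1, by omega⟩
  rcases Int.natAbs_eq e with h | h
  · refine ⟨_, _, N, Or.inl ⟨rfl, rfl⟩, ?_⟩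
    rw [h, hN, zpow_natCast, map_pow, map_pow, ← div_pow, ← eq_fnum_div_fden]
  · refine ⟨_, _, N, Or.inr ⟨rfl, rfl⟩, ?_⟩
    rw [h, hN, zpow_neg, zpow_natCast, map_pow, map_pow, ← div_pow, ← inv_pow, ← inv_div,
      ← eq_fnum_div_fden]

theorem eval_eq_zero_of_dvd {q a : R2 k} (h : q ∣ a) (hq : eval 0 q = 0) :
    eval (0 : Fin 2 → k) a = 0 := by
  obtain ⟨e, rfl⟩ := h
  rw [map_mul, hq, zero_mul]

/-- If `q` divides `f` or `1 / f` but not `g`, and the tame symbol of `{f, g}` at `q` is constant,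
then `g` is constant along `q`; if moreover the numerator or denominator of `g` vanishes at the
origin, both do. -/
theorem TameAgree.eval_eq_zero_of_constant (hν : IsValFamily ν) {f g x y : (FF k)ˣ}
    (hT : TameAgree ν f g x y) {q : R2 k} (hq : Prime q) (hq0 : eval 0 q = 0)
    (hf : q ∣ fnum (f : FF k) ∨ q ∣ fden (f : FF k))
    (hg : ¬ (q ∣ fnum (g : FF k) ∨ q ∣ fden (g : FF k)))
    (hx : ν (primeH1 q hq) x = 0) (hy : ν (primeH1 q hq) y = 0)
    (h0 : eval 0 (fnum (g : FF k)) = 0 ∨ eval 0 (fden (g : FF k)) = 0) :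
    eval 0 (fnum (g : FF k)) = 0 ∧ eval 0 (fden (g : FF k)) = 0 := by
  have hνf : ν (primeH1 q hq) f ≠ 0 := fun h => (hν.eq_zero_iff_fnum_fden hq f).mp h hf
  have hνg := (hν.eq_zero_iff_fnum_fden hq g).mpr hg
  obtain ⟨α, β, N, hαβ, hpow⟩ := exists_zpow_eq_div (g : FF k) hνf
  push Not at hg
  have hα : ¬ q ∣ α := by rcases hαβ with ⟨rfl, rfl⟩ | ⟨rfl, rfl⟩ <;> tauto
  have hβ : ¬ q ∣ β := by rcases hαβ with ⟨rfl, rfl⟩ | ⟨rfl, rfl⟩ <;> tauto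
  have hpow_mem : ∀ {a : R2 k} {M : ℕ}, ¬ q ∣ a → a ^ M ∉ (primeH1 q hq).1.asIdeal :=
    fun ha h => ha (hq.dvd_of_dvd_pow ((mem_primeH1 hq _).mp h))
  have h1 : (1 : R2 k) ∉ (primeH1 q hq).1.asIdeal := by
    rw [mem_primeH1]
    exact hq.not_dvd_one
  obtain ⟨c, hc, hmem⟩ := hT (primeH1 q hq) (α ^ (N + 1)) (β ^ (N + 1)) 1 1
    (hpow_mem hα) (hpow_mem hβ) h1 h1
    (by rw [tameRatio, hνg, mul_zero, neg_zero, zpow_zero, zpow_zero, one_mul, mul_one, hpow])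
    (by simp [tameRatio, hx, hy])
  rw [mem_primeH1] at hmem
  have hev := eval_eq_zero_of_dvd hmem hq0
  simp only [map_sub, map_mul, map_pow, mul_one, eval_C, sub_eq_zero] at hev
  have hiff : eval 0 α = 0 ↔ eval 0 β = 0 := by
    constructor <;> intro h <;> simpa [h, hc, -eval_zero] using hev
  rcases hαβ with ⟨rfl, rfl⟩ | ⟨rfl, rfl⟩ <;> tauto

/-- If the tame symbol of `{f, g}` at the line `x` is `y` up to a constant and both `y` and
another curve `q` through the origin divide `f` or `1 / f`, then both the numerator and the
denominator of `f` vanish at the origin. -/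
theorem TameAgree.eval_eq_zero_of_line (hν : IsValFamily ν) {f g x y : (FF k)ˣ}
    (hT : TameAgree ν f g x y) {ξ η q : R2 k} (hξ : Prime ξ) (hq : Prime q)
    (hξ0 : eval 0 ξ = 0) (hη0 : eval 0 η = 0) (hq0 : eval 0 q = 0)
    (hx : (x : FF k) = algebraMap (R2 k) (FF k) ξ)
    (hy : (y : FF k) = algebraMap (R2 k) (FF k) η)
    (hξη : ¬ ξ ∣ η) (hqη : ¬ q ∣ η)
    (hfξ : ¬ (ξ ∣ fnum (f : FF k) ∨ ξ ∣ fden (f : FF k)))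
    (hgξ : ξ ∣ fnum (g : FF k) ∨ ξ ∣ fden (g : FF k))
    (hfη : η ∣ fnum (f : FF k) ∨ η ∣ fden (f : FF k))
    (hfq : q ∣ fnum (f : FF k) ∨ q ∣ fden (f : FF k)) :
    eval 0 (fnum (f : FF k)) = 0 ∧ eval 0 (fden (f : FF k)) = 0 := by
  have hνg : ν (primeH1 ξ hξ) g ≠ 0 := fun h => (hν.eq_zero_iff_fnum_fden hξ g).mp h hgξ
  have hνf := (hν.eq_zero_iff_fnum_fden hξ f).mpr hfξ
  have hνx := hν.eq_one hξ hx
  have hνy := (hν.eq_zero_iff hξ hy).mpr hξη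
  obtain ⟨α, β, N, hαβ, hpow⟩ := exists_zpow_eq_div (f : FF k) (neg_ne_zero.mpr hνg)
  push Not at hfξ
  have hα : ¬ ξ ∣ α := by rcases hαβ with ⟨rfl, rfl⟩ | ⟨rfl, rfl⟩ <;> tauto
  have hβ : ¬ ξ ∣ β := by rcases hαβ with ⟨rfl, rfl⟩ | ⟨rfl, rfl⟩ <;> tauto
  have hpow_mem : ∀ {a : R2 k} {M : ℕ}, ¬ ξ ∣ a → a ^ M ∉ (primeH1 ξ hξ).1.asIdeal :=
    fun ha h => ha (hξ.dvd_of_dvd_pow ((mem_primeH1 hξ _).mp h))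
  have h1 : (1 : R2 k) ∉ (primeH1 ξ hξ).1.asIdeal := by
    rw [mem_primeH1]
    exact hξ.not_dvd_one
  obtain ⟨c, hc, hmem⟩ := hT (primeH1 ξ hξ) (α ^ (N + 1)) (β ^ (N + 1)) η 1
    (hpow_mem hα) (hpow_mem hβ) ((mem_primeH1 hξ η).not.mpr hξη) h1
    (by rw [tameRatio, hνf, zero_mul, zpow_zero, zpow_zero, one_mul, one_mul, hpow])
    (by simp [tameRatio, hνx, hνy, hy])
  rw [mem_primeH1, mul_one] at hmem
  have hα0 : eval 0 α = 0 := by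
    have hev := eval_eq_zero_of_dvd hmem hξ0
    simpa [hη0, -eval_zero] using hev
  have hβ0 : eval 0 β = 0 := by
    by_contra hβ0
    have hηα : η ∣ α := by
      have : ¬ η ∣ β := fun h => hβ0 (eval_eq_zero_of_dvd h hη0)
      rcases hαβ with ⟨rfl, rfl⟩ | ⟨rfl, rfl⟩ <;> tauto
    have hqα : q ∣ α := by
      have : ¬ q ∣ β := fun h => hβ0 (eval_eq_zero_of_dvd h hq0)
      rcases hαβ with ⟨rfl, rfl⟩ | ⟨rfl, rfl⟩ <;> tauto
    obtain ⟨γ, hγ⟩ := hηα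
    have hqγ : q ∣ γ := (hq.dvd_or_dvd (hγ ▸ hqα)).resolve_left hqη
    have hfac : α ^ (N + 1) - C c * η * β ^ (N + 1) =
        η * (γ * α ^ N - C c * β ^ (N + 1)) := by
      rw [pow_succ α]
      linear_combination α ^ N * hγ
    rw [hfac] at hmem
    have hev := eval_eq_zero_of_dvd ((hξ.dvd_or_dvd hmem).resolve_left hξη) hξ0
    simp [eval_eq_zero_of_dvd hqγ hq0, hc, hβ0, -eval_zero] at hev
  rcases hαβ with ⟨rfl, rfl⟩ | ⟨rfl, rfl⟩ <;> tauto

theorem not_onCrv_pt0_of_component [Infinite k] (hν : IsValFamily ν) {f g x y : (FF k)ˣ}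
    (hT : TameAgree ν f g x y) {i j : Fin 2} (hij : i ≠ j)
    (hx : (x : FF k) = algebraMap (R2 k) (FF k) (X i))
    (hy : (y : FF k) = algebraMap (R2 k) (FF k) (X j))
    (hf : divP (f : FF k) (Ideal.span {X j.castSucc}) ≠ 0)
    (hg : divP (g : FF k) (Ideal.span {X i.castSucc}) ≠ 0)
    (hcomp : ∀ I : Ideal (MvPolynomial (Fin 3) k),
      I ≠ lInf k → ¬(divP (f : FF k) I ≠ 0 ∧ divP (g : FF k) I ≠ 0))
    (hBs : ¬ ((pt0 k ∈ posLocus (divP (f : FF k)) ∧ pt0 k ∈ negLocus (divP (f : FF k))) ∧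
      pt0 k ∈ posLocus (divP (g : FF k)) ∧ pt0 k ∈ negLocus (divP (g : FF k))))
    {I : Ideal (MvPolynomial (Fin 3) k)} (hI : divP (f : FF k) I ≠ 0)
    (hIj : I ≠ Ideal.span {X j.castSucc}) (hIi : I ≠ Ideal.span {X i.castSucc}) :
    ¬ onCrv (pt0 k) I := by
  intro h0
  obtain ⟨π, n, hπ, hn, hq0, rfl⟩ := exists_prime_form_of_divP_ne_zero f hI h0
  have hu := not_isUnit_of_eval_eq_zero hq0
  have hq := prime_dehom hπ hn hu
  have hX0 : ∀ l : Fin 2, eval (0 : Fin 2 → k) (dehom k (X l.castSucc)) = 0 := fun l => by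
    simp [dehom_X_castSucc]
  have hcomponent : ∀ (F : (FF k)ˣ) (l : Fin 2),
      divP (F : FF k) (Ideal.span {X l.castSucc}) ≠ 0 ↔
        X l ∣ fnum (F : FF k) ∨ X l ∣ fden (F : FF k) := fun F l => by
    rw [divP_span_ne_zero_iff F (X_prime (i := l.castSucc)) (isHomogeneous_X k _)
      (not_isUnit_of_eval_eq_zero (hX0 l)), dehom_X_castSucc]
  have hqX : ∀ l : Fin 2, Ideal.span {π} ≠ Ideal.span {(X l.castSucc : MvPolynomial (Fin 3) k)} →
      ¬ dehom k π ∣ X l := fun l hl hd => by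
    rw [← dehom_X_castSucc, ← dvd_iff_dehom_dvd hπ hn (isHomogeneous_X k _) (not_dvd_X_two hu)]
      at hd
    exact hl (Ideal.span_singleton_eq_span_singleton.mpr
      (hπ.associated_of_dvd (X_prime (i := l.castSucc)) hd))
  have hfi : ¬ divP (f : FF k) (Ideal.span {X i.castSucc}) ≠ 0 := fun h =>
    hcomp _ (span_ne_lInf (not_isUnit_of_eval_eq_zero (hX0 i))) ⟨h, hg⟩
  have hgq : ¬ divP (g : FF k) (Ideal.span {π}) ≠ 0 := fun h =>
    hcomp _ (span_ne_lInf hu) ⟨hI, h⟩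
  rw [hcomponent] at hf hg hfi
  rw [divP_span_ne_zero_iff _ hπ hn hu] at hI hgq
  have hev : ∀ l : Fin 2, eval (0 : Fin 2 → k) (X l) = 0 := fun l => by simp
  have hF := hT.eval_eq_zero_of_line hν (X_prime (i := i)) hq (hev i) (hev j)
    hq0 hx hy (fun h => hij (by simpa using h)) (hqX j hIj) hfi hg hf hI
  have hG := hT.eval_eq_zero_of_constant hν hq hq0 hI hgq
    ((hν.eq_zero_iff hq hx).mpr (hqX i hIi)) ((hν.eq_zero_iff hq hy).mpr (hqX j hIj))
    (hg.imp (eval_eq_zero_of_dvd · (hev i)) (eval_eq_zero_of_dvd · (hev i)))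
  exact hBs ⟨⟨pt0_mem_posLocus f hF.1, pt0_mem_negLocus f hF.2⟩,
    pt0_mem_posLocus g hG.1, pt0_mem_negLocus g hG.2⟩

end Components

open MvPolynomial in
/-- Let `k` be an algebraically closed field of characteristic 0, and let
`f, g ∈ k(x,y)*` with divisors `D = div f`, `E = div g` on `ℙ²`.  Assume: (i) at every
height-one prime `p` of `k[x,y]` the tame symbols `∂_p{f,g}` and `∂_p{x,y}` agree up to
multiplication by a constant in `k*`; (ii) `l_h` is a component of `D` and `l_v` is a
component of `E`; (iii) `D` and `E` have no common irreducible components except possibly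
`l_∞`; (iv) `|D⁺| ∩ |D⁻| ∩ |E⁺| ∩ |E⁻| = ∅`.  Then every irreducible component `C` of `D`
or of `E` with `C ≠ l_h` and `C ≠ l_v` does not pass through the point `0 = [0:0:1]`. -/
theorem components_avoid_origin
    (k : Type) [Field k] [IsAlgClosed k] [CharZero k]
    (f g : (FF k)ˣ)
    (xu yu : (FF k)ˣ)
    (hxu : (xu : FF k) = algebraMap (R2 k) (FF k) (X 0))
    (hyu : (yu : FF k) = algebraMap (R2 k) (FF k) (X 1))
    -- the discrete valuations `ν_p` attached to the height-one primes `p` of `k[x,y]`: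
    (ν : H1 (R2 k) → (FF k)ˣ → ℤ)
    (hν_mul : ∀ p f g, ν p (f * g) = ν p f + ν p g)
    (hν_char : ∀ (p : H1 (R2 k)) (a : R2 k) (u : (FF k)ˣ),
      (u : FF k) = algebraMap (R2 k) (FF k) a →
      ∀ m : ℕ, (ν p u = m ↔ a ∈ symbPow p.1 m ∧ a ∉ symbPow p.1 (m + 1)))
    -- the tame symbols `∂_p : K₂ᴹ(k(x,y)) → κ(p)*`:
    (tameAt : ∀ p : H1 (R2 k), MilnorK2 (FF k) →+ Additive (kappa p.1)ˣ)
    (htameAt : ∀ (p : H1 (R2 k)) (f g : (FF k)ˣ) (a s : R2 k),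
      a ∉ p.1.asIdeal → s ∉ p.1.asIdeal →
      ((-1 : FF k) ^ (ν p f * ν p g) * (g : FF k) ^ (ν p f) * (f : FF k) ^ (-(ν p g))
        = algebraMap (R2 k) (FF k) a / algebraMap (R2 k) (FF k) s) →
      ∀ u : (kappa p.1)ˣ, (u : kappa p.1) * resid p.1 s = resid p.1 a →
        tameAt p (MilnorK2.symbol f g) = Additive.ofMul u)
    -- (i) at every height-one prime `p` of `k[x,y]`, `∂_p{f,g}` and `∂_p{x,y}` agree up to
    -- multiplication by an element of `k*`:
    (hfg_xy : ∀ p : H1 (R2 k), ∃ c : kˣ,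
      tameAt p (MilnorK2.symbol f g) = tameAt p (MilnorK2.symbol xu yu)
        + Additive.ofMul (Units.map (algebraMap k (kappa p.1)).toMonoidHom c))
    -- (ii) `l_h` is a component of `D = div f`, `l_v` is a component of `E = div g`:
    (hlh : divP (f : FF k) (lH k) ≠ 0)
    (hlv : divP (g : FF k) (lV k) ≠ 0)
    -- (iii) no common irreducible components except possibly `l_∞`:
    (hcomp : ∀ I : Ideal (MvPolynomial (Fin 3) k),
      I ≠ lInf k → ¬(divP (f : FF k) I ≠ 0 ∧ divP (g : FF k) I ≠ 0))
    -- (iv) `|D⁺| ∩ |D⁻| ∩ |E⁺| ∩ |E⁻| = ∅`: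
    (hBs : posLocus (divP (f : FF k)) ∩ negLocus (divP (f : FF k))
      ∩ posLocus (divP (g : FF k)) ∩ negLocus (divP (g : FF k)) = ∅) :
    ∀ I : Ideal (MvPolynomial (Fin 3) k),
      (divP (f : FF k) I ≠ 0 ∨ divP (g : FF k) I ≠ 0) →
      I ≠ lH k → I ≠ lV k → ¬ onCrv (pt0 k) I := by
  have hT := tameAgree_of_tameAt tameAt htameAt hfg_xy
  have hν : IsValFamily ν := ⟨hν_mul, hν_char⟩
  have hBs0 := Set.eq_empty_iff_forall_notMem.mp hBs (pt0 k)
  have hH : lH k = Ideal.span {X (Fin.castSucc (1 : Fin 2))} := rfl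
  have hV : lV k = Ideal.span {X (Fin.castSucc (0 : Fin 2))} := rfl
  intro I hI hIh hIv
  rw [hH] at hlh hIh
  rw [hV] at hlv hIv
  rcases hI with hI | hI
  · exact not_onCrv_pt0_of_component hν hT zero_ne_one hxu hyu hlh hlv hcomp
      (fun h => hBs0 ⟨⟨⟨h.1.1, h.1.2⟩, h.2.1⟩, h.2.2⟩) hI hIh hIv
  · exact not_onCrv_pt0_of_component hν hT.swap one_ne_zero hyu hxu hlv hlh
      (fun J hJ h => hcomp J hJ h.symm)
      (fun h => hBs0 ⟨⟨⟨h.2.1, h.2.2⟩, h.1.1⟩, h.1.2⟩) hI hIv hIh
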